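/- arXiv:math/0612443 — 3 statements merged into one kernel-verified Lean document; each statement's English description precedes it below -/
import Mathlib

section
/- Let r ≥ 1 and let b_1, …, b_r be integers such that for every n with 1 ≤ n ≤ r and every prime p dividing n, b_n ≡ b_(n/p) (mod p^k), where k is the exponent of p in n. Then there exists an r × r matrix f with integer entries such that b_n = Tr(f^n) for all 1 ≤ n ≤ r. -/
theorem aux_int_dvd (n : ℕ) (hn : n ≠ 0) (z : ℤ)
    (h : ∀ p : ℕ, p.Prime → p ∣ n → (p : ℤ) ^ (n.factorization p) ∣ z) : (n : ℤ) ∣ z := by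
  rw [Int.natCast_dvd, Nat.dvd_iff_prime_pow_dvd_dvd]
  intro p k hp hk
  rcases Nat.eq_zero_or_pos k with rfl | hkpos
  · simp
  have hpn : p ∣ n := (dvd_pow_self p hkpos.ne').trans hk
  have h1 := h p hp hpn
  have h2 : k ≤ n.factorization p := (hp.pow_dvd_iff_le_factorization hn).1 hk
  have h3 : p ^ (n.factorization p) ∣ z.natAbs := by
    rw [← Int.natCast_dvd]; exact_mod_cast h1
  exact (pow_dvd_pow p h2).trans h3

theorem aux_c (r : ℕ) (b : ℕ → ℤ)
    (hcong : ∀ n : ℕ, 1 ≤ n → n ≤ r → ∀ p : ℕ, p.Prime → p ∣ n →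
      b n ≡ b (n / p) [ZMOD (p : ℤ) ^ (n.factorization p)]) (m : ℕ) (hm : m ≤ r) :
    ∃ c : ℕ → ℤ, ∀ n, 1 ≤ n → n ≤ m → ∑ d ∈ n.divisors, (d : ℤ) * c d = b n := by
  induction m with
  | zero => exact ⟨0, fun n h1 h2 => by omega⟩
  | succ m ih =>
    obtain ⟨c, hc⟩ := ih (by omega)
    have hdvd : ((m + 1 : ℕ) : ℤ) ∣ b (m+1) - ∑ d ∈ (m+1).properDivisors, (d : ℤ) * c d := by
      apply aux_int_dvd _ (by omega)
      intro p hp hpn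
      have h1 := (hcong (m+1) (by omega) hm p hp hpn).symm.dvd
      have hlt : (m+1)/p < m+1 := Nat.div_lt_self (by omega) hp.one_lt
      have hpos : 1 ≤ (m+1)/p := Nat.div_pos (Nat.le_of_dvd (by omega) hpn) hp.pos
      have h2 := hc ((m+1)/p) hpos (by omega)
      have hsub : ((m+1)/p).divisors ⊆ (m+1).properDivisors := by
        intro d hd
        rw [Nat.mem_divisors] at hd
        rw [Nat.mem_properDivisors]
        exact ⟨hd.1.trans (Nat.div_dvd_of_dvd hpn), (Nat.le_of_dvd (by omega) hd.1).trans_lt hlt⟩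
      rw [← Finset.sum_sdiff hsub, h2]
      have h3 : (p : ℤ) ^ ((m+1).factorization p) ∣
          ∑ d ∈ (m+1).properDivisors \ ((m+1)/p).divisors, (d : ℤ) * c d := by
        apply Finset.dvd_sum
        intro d hd
        apply Dvd.dvd.mul_right
        rw [Finset.mem_sdiff, Nat.mem_properDivisors, Nat.mem_divisors] at hd
        obtain ⟨⟨hdm, hdl⟩, hnd⟩ := hd
        have hnd' : ¬ d ∣ (m+1)/p := fun h => hnd ⟨h, by omega⟩
        obtain ⟨e, he⟩ := hdm
        have hpe : ¬ p ∣ e := by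
          rintro ⟨f, rfl⟩
          apply hnd'
          rw [he, show d * (p * f) = p * (d * f) by ring, Nat.mul_div_cancel_left _ hp.pos]
          exact Dvd.intro _ rfl
        have h4 : p ^ ((m+1).factorization p) ∣ d * e := he ▸ Nat.ordProj_dvd (m+1) p
        have h5 := Nat.Coprime.dvd_of_dvd_mul_right
          (Nat.Coprime.pow_left _ ((Nat.Prime.coprime_iff_not_dvd hp).2 hpe)) h4
        exact_mod_cast h5
      rw [show ∀ x y z : ℤ, x - (y + z) = x - z - y from fun _ _ _ => by ring]
      exact dvd_sub h1 h3
    obtain ⟨z, hz⟩ := hdvd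
    refine ⟨Function.update c (m+1) z, fun n h1 h2 => ?_⟩
    have hprop : ∀ n, n ≤ m + 1 → ∑ d ∈ n.properDivisors, (d : ℤ) * Function.update c (m+1) z d
        = ∑ d ∈ n.properDivisors, (d : ℤ) * c d := by
      intro n hn
      apply Finset.sum_congr rfl
      intro d hd
      rw [Nat.mem_properDivisors] at hd
      rw [Function.update_of_ne (by omega)]
    rw [← Nat.cons_self_properDivisors (by omega), Finset.sum_cons, hprop n h2]
    rcases Nat.lt_or_ge m n with h | h
    · obtain rfl : n = m + 1 := by omega
      rw [Function.update_self, ← hz]; ring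
    · rw [Function.update_of_ne (by omega), ← hc n h1 h,
        ← Nat.cons_self_properDivisors (by omega), Finset.sum_cons]

open PowerSeries in
/-- Negated logarithmic derivatives (times X) form a subgroup. -/
noncomputable def auxSub : AddSubgroup (PowerSeries ℤ) where
  carrier := {S | ∃ P : PowerSeries ℤ, constantCoeff P = 1 ∧
    X * derivative ℤ P = -(P * S)}
  zero_mem' := ⟨1, by simp, by simp⟩
  add_mem' := by
    rintro S T ⟨P, hP, hP'⟩ ⟨Q, hQ, hQ'⟩
    refine ⟨P * Q, by simp [hP, hQ], ?_⟩
    rw [Derivation.leibniz, smul_eq_mul, smul_eq_mul]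
    linear_combination Q * hP' + P * hQ'
  neg_mem' := by
    rintro S ⟨P, hP, hP'⟩
    have hu : IsUnit P := by
      rw [PowerSeries.isUnit_iff_constantCoeff, hP]; exact isUnit_one
    obtain ⟨Q, hQ⟩ := hu.exists_right_inv
    refine ⟨Q, ?_, ?_⟩
    · have := congrArg constantCoeff hQ
      simpa [hP] using this
    · have h1 := congrArg (derivative ℤ) hQ
      rw [Derivation.leibniz, smul_eq_mul, smul_eq_mul] at h1
      simp only [Derivation.map_one_eq_zero] at h1
      linear_combination X * Q * h1 - Q * Q * hP' - (X * derivative ℤ Q - Q * S) * hQ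

open PowerSeries in
theorem aux_mem (d : ℕ) (hd : 1 ≤ d) :
    (PowerSeries.mk fun n => if d ∣ n ∧ n ≠ 0 then (d : ℤ) else 0) ∈ auxSub := by
  refine ⟨1 - X ^ d, by simp [show d ≠ 0 by omega], ?_⟩
  have h1 : X * derivative ℤ (1 - X ^ d : PowerSeries ℤ) = - ((d : PowerSeries ℤ) * X ^ d) := by
    obtain ⟨e, rfl⟩ : ∃ e, d = e + 1 := ⟨d - 1, by omega⟩
    simp [Derivation.leibniz_pow]
    ring
  rw [h1]
  congr 1
  rw [sub_mul, one_mul]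
  ext n
  rw [map_sub, coeff_X_pow_mul', coeff_mk, ← map_natCast (C (R := ℤ)), coeff_C_mul, coeff_X_pow]
  by_cases hdn : d ≤ n
  · obtain ⟨k, rfl⟩ := Nat.exists_eq_add_of_le hdn
    have : k ≠ 0 ∨ k = 0 := by omega
    rcases this with hk | rfl
    · simp [hk]
    · simp
  · have : ¬ (d ∣ n ∧ n ≠ 0) := fun h => hdn (Nat.le_of_dvd (by omega) h.1)
    rw [if_neg this, if_neg hdn, if_neg (by omega)]; simp

/-- Newton coefficients. -/
theorem aux_newton (r : ℕ) (b : ℕ → ℤ)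
    (hcong : ∀ n : ℕ, 1 ≤ n → n ≤ r → ∀ p : ℕ, p.Prime → p ∣ n →
      b n ≡ b (n / p) [ZMOD (p : ℤ) ^ (n.factorization p)]) :
    ∃ q : ℕ → ℤ, q 0 = 1 ∧ ∀ n, 1 ≤ n → n ≤ r →
      ∑ i ∈ Finset.range n, q i * b (n - i) = - (n * q n) := by
  obtain ⟨c, hc⟩ := aux_c r b hcong r le_rfl
  have hmem : (∑ d ∈ Finset.Icc 1 r, c d •
      (PowerSeries.mk fun n => if d ∣ n ∧ n ≠ 0 then (d : ℤ) else 0)) ∈ auxSub :=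
    sum_mem fun d hd => zsmul_mem (aux_mem d (Finset.mem_Icc.1 hd).1) _
  set S := (∑ d ∈ Finset.Icc 1 r, c d •
      (PowerSeries.mk fun n => if d ∣ n ∧ n ≠ 0 then (d : ℤ) else 0)) with hS
  have hS0 : PowerSeries.coeff 0 S = 0 := by
    rw [hS, map_sum]
    apply Finset.sum_eq_zero
    intro d hd
    rw [map_zsmul, PowerSeries.coeff_mk]; simp
  have hSn : ∀ n, 1 ≤ n → n ≤ r → PowerSeries.coeff n S = b n := by
    intro n h1 h2
    rw [← hc n h1 h2, hS, map_sum]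
    have : n.divisors = (Finset.Icc 1 r).filter (· ∣ n) := by
      ext d
      simp only [Nat.mem_divisors, Finset.mem_filter, Finset.mem_Icc]
      constructor
      · rintro ⟨h, _⟩
        exact ⟨⟨Nat.pos_of_dvd_of_pos h (by omega), (Nat.le_of_dvd (by omega) h).trans h2⟩, h⟩
      · rintro ⟨_, h⟩
        exact ⟨h, by omega⟩
    rw [this, Finset.sum_filter]
    apply Finset.sum_congr rfl
    intro d hd
    rw [map_zsmul, PowerSeries.coeff_mk]
    by_cases h : d ∣ n
    · rw [if_pos ⟨h, by omega⟩, if_pos h, smul_eq_mul, mul_comm]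
    · rw [if_neg (fun h' => h h'.1), if_neg h, smul_zero]
  obtain ⟨P, hP, hP'⟩ := hmem
  refine ⟨fun i => PowerSeries.coeff i P, by simpa using hP, fun n h1 h2 => ?_⟩
  have h3 := congrArg (PowerSeries.coeff n) hP'
  obtain ⟨m, rfl⟩ : ∃ m, n = m + 1 := ⟨n - 1, by omega⟩
  rw [PowerSeries.coeff_succ_X_mul, PowerSeries.coeff_derivative, map_neg, PowerSeries.coeff_mul,
    Finset.Nat.sum_antidiagonal_eq_sum_range_succ
      (fun i j => PowerSeries.coeff i P * PowerSeries.coeff j S), Finset.sum_range_succ,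
    Nat.sub_self, hS0, mul_zero, add_zero] at h3
  have h4 : ∑ i ∈ Finset.range (m+1), PowerSeries.coeff i P * b (m + 1 - i) =
      ∑ i ∈ Finset.range (m+1), PowerSeries.coeff i P * PowerSeries.coeff (m + 1 - i) S := by
    apply Finset.sum_congr rfl
    intro i hi
    rw [Finset.mem_range] at hi
    rw [hSn _ (by omega) (by omega)]
  rw [h4]
  push_cast
  linear_combination h3

open Polynomial in
theorem aux_trace (r : ℕ) (q : ℕ → ℤ) (hq0 : q 0 = 1) :
    ∃ f : Matrix (Fin r) (Fin r) ℤ, ∀ n, n ≤ r →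
      ∑ i ∈ Finset.range (n + 1), q i * (f ^ (n - i)).trace = (r - n) * q n := by
  -- lower part and Horner polynomials
  set L : ℕ → ℤ[X] := fun n => ∑ i ∈ Finset.Ico (n+1) (r+1), C (q i) * X ^ (r - i) with hL
  set H : ℕ → ℤ[X] := fun n => ∑ i ∈ Finset.range (n+1), C (q i) * X ^ (n - i) with hH
  have hLdeg : ∀ n, n < r → (L n).degree < ((r - n : ℕ) : WithBot ℕ) := by
    intro n hn
    apply (Polynomial.degree_sum_le _ _).trans_lt
    rw [Finset.sup_lt_iff (by exact WithBot.bot_lt_coe _)]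
    intro i hi
    rw [Finset.mem_Ico] at hi
    apply (Polynomial.degree_C_mul_X_pow_le _ _).trans_lt
    exact_mod_cast (by omega : r - i < r - n)
  have hLr : L r = 0 := by simp [hL]
  set Q : ℤ[X] := H r with hQ
  have hQH : ∀ n, n ≤ r → Q = X ^ (r - n) * H n + L n := by
    intro n hn
    simp only [hQ, hH, hL]
    rw [Finset.range_eq_Ico, ← Finset.sum_Ico_consecutive _ (Nat.zero_le (n+1))
      (by omega : n + 1 ≤ r + 1), Finset.range_eq_Ico, Finset.mul_sum]
    congr 1
    apply Finset.sum_congr rfl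
    intro i hi
    rw [Finset.mem_Ico] at hi
    rw [show r - i = (r - n) + (n - i) by omega, pow_add]; ring
  have hQ0 : Q = X ^ r + L 0 := by
    rw [hQH 0 (by omega)]; simp [hH, hq0]
  have hL0 : (L 0).degree < (r : WithBot ℕ) := by
    rcases Nat.eq_zero_or_pos r with h | h
    · subst h; rw [hLr]; simp
    · simpa using hLdeg 0 h
  have hmon : Q.Monic := by
    rw [hQ0]; exact monic_X_pow_add hL0
  have hdegQ : Q.degree = r := by
    rw [hQ0, degree_add_eq_left_of_degree_lt (by simpa using hL0), degree_X_pow]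
  have hdeg : Q.natDegree = r := natDegree_eq_of_degree_eq_some hdegQ
  let B : Module.Basis (Fin r) ℤ (AdjoinRoot Q) :=
    (AdjoinRoot.powerBasisAux' hmon).reindex (finCongr hdeg)
  have hrepr : ∀ (g : ℤ[X]) (i : Fin r), B.repr (AdjoinRoot.mk Q g) i = (g %ₘ Q).coeff i := by
    intro g i
    simp [B, AdjoinRoot.powerBasisAux'_repr_apply_to_fun]
  have hB : ∀ i : Fin r, B i = AdjoinRoot.mk Q (X ^ (i : ℕ)) := by
    intro i
    apply B.repr.injective
    ext j
    rw [hrepr, Module.Basis.repr_self, (modByMonic_eq_self_iff hmon).2, coeff_X_pow,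
      Finsupp.single_apply]
    · simp [Fin.ext_iff, eq_comm]
    · rw [hdegQ, degree_X_pow]; exact_mod_cast i.2
  let Φ := Algebra.leftMulMatrix B
  refine ⟨Φ (AdjoinRoot.root Q), fun n hn => ?_⟩
  have h1 : ∑ i ∈ Finset.range (n + 1), q i * ((Φ (AdjoinRoot.root Q)) ^ (n - i)).trace =
      (Φ (AdjoinRoot.mk Q (H n))).trace := by
    simp only [hH, map_sum, map_mul, map_pow, Matrix.trace_sum, AdjoinRoot.mk_X]
    apply Finset.sum_congr rfl
    intro i hi
    have : Φ (AdjoinRoot.mk Q (C (q i))) = algebraMap ℤ _ (q i) := by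
      rw [AdjoinRoot.mk_C]
      exact Φ.commutes (q i)
    rw [this, ← Algebra.smul_def, Matrix.trace_smul, smul_eq_mul]
  rw [h1, Matrix.trace]
  have h2 : ∀ j : Fin r, (Φ (AdjoinRoot.mk Q (H n))).diag j = if (j : ℕ) < r - n then q n else 0 := by
    intro j
    rw [Matrix.diag_apply, Algebra.leftMulMatrix_eq_repr_mul, hB, ← map_mul, hrepr]
    split_ifs with hj
    · rw [(modByMonic_eq_self_iff hmon).2, coeff_mul_X_pow']
      · simp only [le_refl, if_true, Nat.sub_self, hH, finsetSum_coeff]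
        rw [Finset.sum_eq_single n]
        · simp
        · intro i hi hin
          rw [Finset.mem_range] at hi
          rw [coeff_C_mul, coeff_X_pow, if_neg (by omega), mul_zero]
        · simp
      · rw [hdegQ]
        have : (H n * X ^ (j : ℕ)).degree ≤ ((n + j : ℕ) : WithBot ℕ) := by
          apply (degree_mul_le _ _).trans
          rw [degree_X_pow]
          push_cast
          gcongr
          apply (Polynomial.degree_sum_le _ _).trans
          apply Finset.sup_le
          intro i hi
          apply (Polynomial.degree_C_mul_X_pow_le _ _).trans
          exact_mod_cast Nat.sub_le _ _
        apply this.trans_lt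
        exact_mod_cast (by omega : n + (j : ℕ) < r)
    · have h3 : H n * X ^ (j : ℕ) = - (L n * X ^ ((j : ℕ) - (r - n))) +
          Q * X ^ ((j : ℕ) - (r - n)) := by
        rw [hQH n hn]
        conv_lhs => rw [show (j : ℕ) = (r - n) + ((j : ℕ) - (r - n)) by omega, pow_add]
        ring
      have h4 : (- (L n * X ^ ((j : ℕ) - (r - n)))).degree < ((j : ℕ) : WithBot ℕ) := by
        rw [degree_neg]
        rcases Nat.lt_or_ge n r with h | h
        · by_cases hz : L n = 0
          · rw [hz, zero_mul, degree_zero]; exact WithBot.bot_lt_coe _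
          have h5 := hLdeg n h
          rw [degree_eq_natDegree hz] at h5
          have h6 : (L n).natDegree < r - n := by exact_mod_cast h5
          rw [degree_mul, degree_X_pow, degree_eq_natDegree hz]
          exact_mod_cast (by omega : (L n).natDegree + ((j : ℕ) - (r - n)) < j)
        · obtain rfl : n = r := by omega
          rw [hLr, zero_mul, degree_zero]; exact WithBot.bot_lt_coe _
      rw [h3, add_modByMonic, (modByMonic_eq_zero_iff_dvd hmon).2 (dvd_mul_right _ _), add_zero,
        (modByMonic_eq_self_iff hmon).2]
      · exact coeff_eq_zero_of_degree_lt h4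
      · rw [hdegQ]
        exact h4.trans (by exact_mod_cast j.2)
  rw [Finset.sum_congr rfl fun j _ => h2 j,
    Fin.sum_univ_eq_sum_range (fun j => if j < r - n then q n else 0) r, ← Finset.sum_filter]
  have : (Finset.range r).filter (· < r - n) = Finset.range (r - n) := by
    ext j; simp; omega
  rw [this, Finset.sum_const, Finset.card_range, nsmul_eq_mul, Nat.cast_sub hn]

theorem stmt_9 (r : ℕ) (hr : 1 ≤ r) (b : ℕ → ℤ)
    (hcong : ∀ n : ℕ, 1 ≤ n → n ≤ r → ∀ p : ℕ, p.Prime → p ∣ n →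
      b n ≡ b (n / p) [ZMOD (p : ℤ) ^ (n.factorization p)]) :
    ∃ f : Matrix (Fin r) (Fin r) ℤ, ∀ n : ℕ, 1 ≤ n → n ≤ r → b n = (f ^ n).trace := by
  obtain ⟨q, hq0, hq⟩ := aux_newton r b hcong
  obtain ⟨f, hf⟩ := aux_trace r q hq0
  refine ⟨f, fun n => ?_⟩
  induction n using Nat.strong_induction_on with
  | _ n ih =>
    intro h1 h2
    have e1 := hq n h1 h2
    have e2 := hf n h2
    rw [Finset.sum_range_succ, Nat.sub_self, pow_zero, Matrix.trace_one, Fintype.card_fin] at e2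
    obtain ⟨m, rfl⟩ : ∃ m, n = m + 1 := ⟨n - 1, by omega⟩
    rw [Finset.sum_range_succ'] at e1 e2
    have e3 : ∑ i ∈ Finset.range m, q (i + 1) * b (m + 1 - (i + 1)) =
        ∑ i ∈ Finset.range m, q (i + 1) * (f ^ (m + 1 - (i + 1))).trace := by
      apply Finset.sum_congr rfl
      intro i hi
      rw [Finset.mem_range] at hi
      rw [ih _ (by omega) (by omega) (by omega)]
    rw [e3] at e1
    simp only [hq0, Nat.sub_zero, one_mul] at e1 e2
    push_cast at e1 e2
    linear_combination e1 - e2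
end

section
/- Let r ≥ 1 and let b_1, …, b_r be integers. There exists an r × r matrix f with integer entries such that b_n = Tr(f^n) for all 1 ≤ n ≤ r if and only if for every n with 1 ≤ n ≤ r and every prime p dividing n, b_n ≡ b_(n/p) (mod p^k), where k is the exponent of p in n. -/
lemma aux_coe_int (c : ℤ) : (((c : Polynomial ℤ)) : PowerSeries ℤ) = (c : PowerSeries ℤ) :=
  map_intCast (Polynomial.coeToPowerSeries.ringHom (R := ℤ)) c

lemma aux_coe_nat (c : ℕ) : (((c : Polynomial ℤ)) : PowerSeries ℤ) = (c : PowerSeries ℤ) :=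
  map_natCast (Polynomial.coeToPowerSeries.ringHom (R := ℤ)) c

open Polynomial in
/-- Jacobi's formula for polynomial matrices. -/
lemma aux_jacobi {r : ℕ} (M : Matrix (Fin r) (Fin r) ℤ[X]) :
    derivative M.det = (M.adjugate * M.map derivative).trace := by
  have h1 : derivative M.det
      = ∑ i, (M.updateCol i (fun j => derivative (M j i))).det := by
    simp only [Matrix.det_apply, map_sum]
    rw [Finset.sum_comm]
    refine Finset.sum_congr rfl fun σ _ => ?_
    rw [Units.smul_def, Polynomial.derivative_smul, Polynomial.derivative_prod_finset, Finset.smul_sum]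
    refine Finset.sum_congr rfl fun i _ => ?_
    rw [Units.smul_def]
    congr 1
    rw [← Finset.prod_erase_mul _ _ (Finset.mem_univ i)]
    congr 1
    · refine Finset.prod_congr rfl fun j hj => ?_
      rw [Matrix.updateCol_ne (Finset.ne_of_mem_erase hj)]
    · rw [Matrix.updateCol_self]
  rw [h1, Matrix.trace]
  refine Finset.sum_congr rfl fun i _ => ?_
  rw [← Matrix.cramer_apply, Matrix.cramer_eq_adjugate_mulVec, Matrix.diag_apply,
    Matrix.mul_apply]
  rfl

/-- The generating series of traces of positive powers. -/
noncomputable def auxS {r : ℕ} (A : Matrix (Fin r) (Fin r) ℤ) : PowerSeries ℤ :=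
  PowerSeries.mk fun n => if n = 0 then 0 else (A ^ n).trace

open PowerSeries in
/-- Newton's identity. -/
lemma aux_newton_s10 {r : ℕ} (A : Matrix (Fin r) (Fin r) ℤ) :
    (A.charpolyRev : PowerSeries ℤ) * auxS A
      = - (X * d⁄dX ℤ (A.charpolyRev : PowerSeries ℤ)) := by
  let φ : Polynomial ℤ →+* PowerSeries ℤ := Polynomial.coeToPowerSeries.ringHom
  let N : Matrix (Fin r) (Fin r) (Polynomial ℤ) := 1 - (Polynomial.X : Polynomial ℤ) • A.map Polynomial.C
  let G : Matrix (Fin r) (Fin r) (PowerSeries ℤ) :=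
    Matrix.of fun i j => PowerSeries.mk fun n => (A ^ n) i j
  let A' : Matrix (Fin r) (Fin r) (PowerSeries ℤ) := A.map (PowerSeries.C)
  have hN : φ.mapMatrix N = 1 - (X : PowerSeries ℤ) • A' := by
    ext1 i j
    simp [N, A', φ, Matrix.one_apply]
    split_ifs <;> simp [aux_coe_int]
  have hG : (X : PowerSeries ℤ) • (A' * G) = G - 1 := by
    ext i j n
    simp only [Matrix.smul_apply, Matrix.sub_apply, smul_eq_mul, map_sub]
    rcases n with _ | n
    · simp [G, Matrix.one_apply]
    · rw [PowerSeries.coeff_succ_X_mul, Matrix.mul_apply]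
      have h0 : PowerSeries.coeff (n + 1) ((1 : Matrix (Fin r) (Fin r) (PowerSeries ℤ)) i j) = 0 := by
        rw [Matrix.one_apply]
        split_ifs <;> simp [PowerSeries.coeff_one]
      rw [h0, sub_zero, map_sum]
      simp only [G, A', Matrix.of_apply, Matrix.map_apply, PowerSeries.coeff_C_mul,
        PowerSeries.coeff_mk, pow_succ', Matrix.mul_apply]
  have hNG : φ.mapMatrix N * G = 1 := by
    rw [hN, sub_mul, Matrix.smul_mul, hG]; simp
  have hadj : φ.mapMatrix N.adjugate = (A.charpolyRev : PowerSeries ℤ) • G := by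
    have h1 : φ.mapMatrix N.adjugate * φ.mapMatrix N = (A.charpolyRev : PowerSeries ℤ) • 1 := by
      rw [← map_mul, Matrix.adjugate_mul]
      ext1 i j
      simp [Matrix.one_apply, φ, N, Matrix.charpolyRev]
      split_ifs <;> simp
    calc φ.mapMatrix N.adjugate = φ.mapMatrix N.adjugate * (φ.mapMatrix N * G) := by rw [hNG, mul_one]
      _ = _ := by rw [← mul_assoc, h1, Matrix.smul_mul, one_mul]
  have hder : d⁄dX ℤ (A.charpolyRev : PowerSeries ℤ)
      = - ((A.charpolyRev : PowerSeries ℤ) * (A' * G).trace) := by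
    rw [PowerSeries.derivative_coe]
    have : Polynomial.derivative A.charpolyRev = (N.adjugate * (- A.map Polynomial.C)).trace := by
      rw [Matrix.charpolyRev, aux_jacobi]
      congr 2
      ext1 i j
      simp [Matrix.one_apply]
      split_ifs <;> simp
    rw [this]
    change φ (Matrix.trace (N.adjugate * (- A.map Polynomial.C))) = _
    rw [AddMonoidHom.map_trace φ]
    have h2 : (N.adjugate * (- A.map Polynomial.C)).map φ
        = φ.mapMatrix N.adjugate * (- A') := by
      change φ.mapMatrix _ = _
      rw [map_mul]
      congr 1
      ext1 i j
      simp [φ, A', aux_coe_int]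
    refine (congrArg Matrix.trace h2).trans ?_
    rw [hadj, Matrix.mul_neg, Matrix.trace_neg, Matrix.smul_mul, Matrix.trace_smul,
      Matrix.trace_mul_comm, smul_eq_mul]
  have hS : auxS A = X * (A' * G).trace := by
    rw [← smul_eq_mul, ← Matrix.trace_smul, hG]
    ext n
    simp only [auxS, PowerSeries.coeff_mk, Matrix.trace, map_sum, Matrix.diag_apply,
      Matrix.sub_apply, map_sub, Matrix.one_apply_eq, PowerSeries.coeff_one]
    split_ifs with h
    · subst h; simp [G]
    · simp [G]
  rw [hder, hS]; ring

lemma aux_const {r : ℕ} (A : Matrix (Fin r) (Fin r) ℤ) :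
    PowerSeries.constantCoeff (A.charpolyRev : PowerSeries ℤ) = 1 := by
  rw [Polynomial.constantCoeff_coe, Polynomial.coeff_zero_eq_eval_zero, Matrix.eval_charpolyRev]

lemma aux_unit {r : ℕ} (A : Matrix (Fin r) (Fin r) ℤ) :
    IsUnit (A.charpolyRev : PowerSeries ℤ) := by
  rw [PowerSeries.isUnit_iff_constantCoeff, aux_const]; exact isUnit_one

/-- p divides P^p - P(X^p). -/
lemma aux_frob (p : ℕ) (hp : p.Prime) (P : Polynomial ℤ) :
    (p : Polynomial ℤ) ∣ P ^ p - Polynomial.expand ℤ p P := by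
  have : Fact p.Prime := ⟨hp⟩
  have : (Polynomial.C (p : ℤ)) ∣ P ^ p - Polynomial.expand ℤ p P := by
    rw [Polynomial.C_dvd_iff_dvd_coeff]
    intro i
    rw [← ZMod.intCast_zmod_eq_zero_iff_dvd]
    have h : (P ^ p - Polynomial.expand ℤ p P).map (Int.castRingHom (ZMod p)) = 0 := by
      rw [Polynomial.map_sub, Polynomial.map_pow, Polynomial.map_expand, ZMod.expand_card, sub_self]
    have := congrArg (fun q => Polynomial.coeff q i) h
    rw [Polynomial.coeff_map] at this
    simpa only [Polynomial.coeff_zero, eq_intCast] using this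
  simpa using this

open PowerSeries in
lemma aux_forward {r : ℕ} (A : Matrix (Fin r) (Fin r) ℤ) (n p : ℕ) (hn : 1 ≤ n)
    (hp : p.Prime) (hpn : p ∣ n) :
    (p : ℤ) ^ (n.factorization p) ∣ (A ^ n).trace - (A ^ (n / p)).trace := by
  obtain ⟨k, hk⟩ : ∃ k, n.factorization p = k + 1 :=
    ⟨n.factorization p - 1, by
      have := hp.factorization_pos_of_dvd (by omega) hpn
      omega⟩
  have hdn : (p : ℤ) ^ (k + 1) ∣ (n : ℤ) := by
    have := Nat.ordProj_dvd n p
    rw [hk] at this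
    exact_mod_cast this
  rw [hk]
  have hp0 : p ≠ 0 := hp.ne_zero
  set P := A.charpolyRev with hP
  set S := auxS A with hS
  let Q : PowerSeries ℤ := expand p hp0 (P : PowerSeries ℤ)
  let T : PowerSeries ℤ := expand p hp0 S
  have hQcoe : ((Polynomial.expand ℤ p P : Polynomial ℤ) : PowerSeries ℤ) = Q := by
    ext m
    simp only [Q, Polynomial.coeff_coe, PowerSeries.coeff_expand, Polynomial.coeff_expand hp.pos]
  have hPS : (P : PowerSeries ℤ) * S = - (X * d⁄dX ℤ (P : PowerSeries ℤ)) := aux_newton_s10 A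
  have hXQ : X * d⁄dX ℤ Q = (p : PowerSeries ℤ) * expand p hp0 (X * d⁄dX ℤ (P : PowerSeries ℤ)) := by
    have : d⁄dX ℤ Q = expand p hp0 (d⁄dX ℤ (P : PowerSeries ℤ)) * d⁄dX ℤ (X ^ p) := by
      simp only [Q, expand_apply]
      rw [derivative_subst (HasSubst.X_pow hp0)]
    rw [this, derivative_pow, map_mul, expand_X, derivative_X]
    obtain ⟨q, rfl⟩ : ∃ q, p = q + 1 := ⟨p - 1, by omega⟩
    simp only [Nat.add_sub_cancel]
    ring
  have hQT : X * d⁄dX ℤ Q = - ((p : PowerSeries ℤ) * (Q * T)) := by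
    have : Q * T = - expand p hp0 (X * d⁄dX ℤ (P : PowerSeries ℤ)) := by
      rw [← map_neg, ← hPS, map_mul]
    rw [hXQ, this]; ring
  have hQ1 : constantCoeff Q = 1 := by
    simp only [Q, constantCoeff_expand]; exact aux_const A
  have hQu : IsUnit (Q ^ p ^ k) := by
    apply IsUnit.pow
    rw [isUnit_iff_constantCoeff, hQ1]; exact isUnit_one
  obtain ⟨U, hU⟩ := hQu
  obtain ⟨H, hH⟩ : ((p : PowerSeries ℤ)) ^ (k + 1) ∣ ((P : PowerSeries ℤ) ^ p) ^ p ^ k - Q ^ p ^ k := by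
    apply dvd_sub_pow_of_dvd_sub
    obtain ⟨H, hH⟩ := aux_frob p hp P
    refine ⟨(H : PowerSeries ℤ), ?_⟩
    rw [← hQcoe, ← Polynomial.coe_pow, ← Polynomial.coe_sub, hH, Polynomial.coe_mul, aux_coe_nat]
  have hH' : (P : PowerSeries ℤ) ^ (p ^ (k + 1))
      = Q ^ p ^ k * (1 + (p : PowerSeries ℤ) ^ (k + 1) * (↑U⁻¹ * H)) := by
    have e : Q ^ p ^ k * (↑U⁻¹ * H) = H := by
      rw [← hU, ← mul_assoc, Units.mul_inv, one_mul]
    rw [mul_add, mul_left_comm, e, ← hH, mul_one, pow_succ', pow_mul]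
    ring
  set H1 : PowerSeries ℤ := ↑U⁻¹ * H with hH1
  have hpc : ∀ j : ℕ, d⁄dX ℤ ((p : PowerSeries ℤ) ^ j) = 0 := by
    intro j
    have : ((p : PowerSeries ℤ) ^ j) = C ((p : ℤ) ^ j) := by simp
    rw [this, derivative_C]
  have hpow : ∀ (F : PowerSeries ℤ) (m : ℕ), m ≠ 0 →
      F * d⁄dX ℤ (F ^ m) = (m : PowerSeries ℤ) * F ^ m * d⁄dX ℤ F := by
    intro F m hm
    obtain ⟨q, rfl⟩ : ∃ q, m = q + 1 := ⟨m - 1, by omega⟩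
    rw [derivative_pow]
    simp only [Nat.add_sub_cancel]
    ring
  have hPne : (P : PowerSeries ℤ) ≠ 0 := (aux_unit A).ne_zero
  have hQne : Q ≠ 0 := by
    intro h; rw [h] at hQ1; simp at hQ1
  have h1 : X * d⁄dX ℤ ((P : PowerSeries ℤ) ^ (p ^ (k + 1)))
      = - ((p : PowerSeries ℤ) ^ (k + 1) * ((P : PowerSeries ℤ) ^ (p ^ (k + 1)) * S)) := by
    apply mul_left_cancel₀ hPne
    rw [mul_left_comm, hpow _ _ (pow_ne_zero _ hp0)]
    push_cast
    linear_combination ((-1 : PowerSeries ℤ)) * (-(p : PowerSeries ℤ) ^ (k + 1) * (P : PowerSeries ℤ) ^ (p ^ (k + 1))) * hPS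
  have h2 : X * d⁄dX ℤ (Q ^ p ^ k) = - ((p : PowerSeries ℤ) ^ (k + 1) * (Q ^ p ^ k * T)) := by
    apply mul_left_cancel₀ hQne
    rw [mul_left_comm, hpow _ _ (pow_ne_zero _ hp0)]
    push_cast
    linear_combination ((p : PowerSeries ℤ) ^ k * Q ^ p ^ k) * hQT
  have hpne : (p : PowerSeries ℤ) ^ (k + 1) ≠ 0 := by
    apply pow_ne_zero
    have : (p : PowerSeries ℤ) = C (p : ℤ) := by simp
    rw [this, Ne, map_eq_zero_iff _ (PowerSeries.C_injective)]
    exact_mod_cast hp0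
  have key : S - T = - (X * d⁄dX ℤ H1) - (p : PowerSeries ℤ) ^ (k + 1) * (H1 * (S - T)) := by
    apply mul_left_cancel₀ hpne
    apply mul_left_cancel₀ (pow_ne_zero (p ^ k) hQne)
    have h3 := h1
    rw [hH', Derivation.leibniz, map_add, Derivation.leibniz, hpc] at h3
    simp only [smul_eq_mul, mul_zero, add_zero, Derivation.map_one_eq_zero, zero_add] at h3
    linear_combination h3 - (1 + (p : PowerSeries ℤ) ^ (k + 1) * H1) * h2
  have hc := congrArg (coeff n) key
  have e1 : coeff n S = (A ^ n).trace := by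
    simp [hS, auxS, show n ≠ 0 by omega]
  have e2 : coeff n T = (A ^ (n / p)).trace := by
    have : n / p ≠ 0 := by
      have := Nat.div_pos (Nat.le_of_dvd hn hpn) hp.pos
      omega
    simp only [T, coeff_expand, hpn, if_true, hS, auxS, coeff_mk, this, if_false]
  have e3 : coeff n (X * d⁄dX ℤ H1) = n * coeff n H1 := by
    obtain ⟨q, rfl⟩ : ∃ q, n = q + 1 := ⟨n - 1, by omega⟩
    rw [coeff_succ_X_mul, coeff_derivative]; push_cast; ring
  have e4 : (p : PowerSeries ℤ) ^ (k + 1) = C ((p : ℤ) ^ (k + 1)) := by simp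
  rw [map_sub, map_sub, map_neg, e1, e2, e3, e4, coeff_C_mul] at hc
  rw [hc]
  exact dvd_sub ((dvd_mul_of_dvd_left hdn _).neg_right) (dvd_mul_right _ _)

/-- Every monic integer polynomial of degree r is a characteristic polynomial. -/
lemma aux_companion (r : ℕ) (q : Polynomial ℤ) (hq : q.Monic) (hd : q.natDegree = r) :
    ∃ f : Matrix (Fin r) (Fin r) ℤ, f.charpoly = q := by
  subst hd
  let pb := AdjoinRoot.powerBasis' hq
  refine ⟨Algebra.leftMulMatrix pb.basis pb.gen, ?_⟩
  have h := charpoly_leftMulMatrix pb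
  refine h.trans ?_
  symm
  apply minpoly.unique' ℤ _ hq
  · simp [pb]
  · intro l hl
    by_cases h0 : l = 0
    · exact Or.inl h0
    right
    intro hz
    have : q ∣ l := by
      rw [← AdjoinRoot.mk_eq_zero, ← AdjoinRoot.aeval_eq]
      simpa [pb] using hz
    exact absurd hl (not_lt.mpr (Polynomial.degree_le_of_dvd this h0))

open PowerSeries in
lemma aux_step {r : ℕ} (A B : Matrix (Fin r) (Fin r) ℤ) (m : ℕ) (c : ℤ)
    (h : B.charpolyRev = A.charpolyRev + Polynomial.C c * Polynomial.X ^ (m + 1)) :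
    (∀ n, 1 ≤ n → n ≤ m → (B ^ n).trace = (A ^ n).trace) ∧
      (B ^ (m + 1)).trace = (A ^ (m + 1)).trace - c * (m + 1) := by
  have hA := aux_newton_s10 A
  have hB := aux_newton_s10 B
  have hBu := aux_unit B
  have hBc := aux_const B
  have h' : (B.charpolyRev : PowerSeries ℤ) = (A.charpolyRev : PowerSeries ℤ) + C c * X ^ (m + 1) := by
    rw [h]; simp [aux_coe_int]
  have hd : X * d⁄dX ℤ (B.charpolyRev : PowerSeries ℤ)
      = X * d⁄dX ℤ (A.charpolyRev : PowerSeries ℤ) + X ^ (m + 1) * C (c * (m + 1)) := by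
    rw [h', map_add, Derivation.leibniz, derivative_C, derivative_pow, derivative_X]
    simp only [smul_eq_mul, Nat.add_sub_cancel, map_mul, map_add, map_natCast, map_one]
    push_cast
    ring
  have e : (B.charpolyRev : PowerSeries ℤ) * (auxS B - auxS A)
      = X ^ (m + 1) * (- C (c * (m + 1)) - C c * auxS A) := by
    linear_combination hB - hA - hd - auxS A * h'
  obtain ⟨V, hV⟩ : X ^ (m + 1) ∣ auxS B - auxS A :=
    (hBu.dvd_mul_left).1 ⟨_, e⟩
  have e2 : (B.charpolyRev : PowerSeries ℤ) * V = - C (c * (m + 1)) - C c * auxS A := by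
    apply mul_left_cancel₀ (pow_ne_zero (m + 1) (X_ne_zero (R := ℤ)))
    rw [← e, hV]; ring
  have hV0 : constantCoeff V = - (c * (m + 1)) := by
    have := congrArg constantCoeff e2
    have hs : constantCoeff (auxS A) = 0 := by
      rw [← coeff_zero_eq_constantCoeff_apply]; simp [auxS]
    simp only [map_mul, map_sub, map_neg, hBc, hs, constantCoeff_C] at this
    simpa using this
  have hco : ∀ n, 1 ≤ n → (B ^ n).trace - (A ^ n).trace = coeff n (X ^ (m + 1) * V) := by
    intro n hn
    rw [← hV]
    simp [auxS, show n ≠ 0 by omega]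
  constructor
  · intro n hn hnm
    have := hco n hn
    rw [coeff_X_pow_mul', if_neg (by omega)] at this
    linarith
  · have := hco (m + 1) (by omega)
    rw [coeff_X_pow_mul', if_pos le_rfl, Nat.sub_self, coeff_zero_eq_constantCoeff_apply, hV0] at this
    linarith

lemma aux_perturb {r : ℕ} (A : Matrix (Fin r) (Fin r) ℤ) (m : ℕ) (hm : m + 1 ≤ r) (c : ℤ) :
    ∃ B : Matrix (Fin r) (Fin r) ℤ,
      B.charpolyRev = A.charpolyRev + Polynomial.C c * Polynomial.X ^ (m + 1) := by
  have hdA : A.charpoly.natDegree = r := by simp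
  have hlt : (Polynomial.C c * Polynomial.X ^ (r - (m + 1)) : Polynomial ℤ).degree
      < A.charpoly.degree := by
    rw [Matrix.charpoly_degree_eq_dim]
    refine (Polynomial.degree_C_mul_X_pow_le _ _).trans_lt ?_
    rw [Fintype.card_fin]
    exact_mod_cast (by omega : r - (m + 1) < r)
  have hmon := A.charpoly_monic.add_of_left hlt
  have hdeg : (A.charpoly + Polynomial.C c * Polynomial.X ^ (r - (m + 1))).natDegree = r := by
    rw [Polynomial.natDegree_eq_of_degree_eq (Polynomial.degree_add_eq_left_of_degree_lt hlt), hdA]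
  obtain ⟨B, hB⟩ := aux_companion r _ hmon hdeg
  refine ⟨B, ?_⟩
  rw [← Matrix.reverse_charpoly, ← Matrix.reverse_charpoly, hB, Polynomial.reverse, hdeg,
    Polynomial.reverse, hdA, Polynomial.reflect_add, Polynomial.reflect_C_mul_X_pow,
    Polynomial.revAt_le (by omega), Nat.sub_sub_self hm]

theorem stmt_10 (r : ℕ) (hr : 1 ≤ r) (b : ℕ → ℤ) :
    (∃ f : Matrix (Fin r) (Fin r) ℤ, ∀ n : ℕ, 1 ≤ n → n ≤ r → b n = (f ^ n).trace) ↔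
    (∀ n : ℕ, 1 ≤ n → n ≤ r → ∀ p : ℕ, p.Prime → p ∣ n →
      b n ≡ b (n / p) [ZMOD (p : ℤ) ^ (n.factorization p)]) := by
  have hdivpos : ∀ n p : ℕ, 1 ≤ n → p.Prime → p ∣ n → 1 ≤ n / p := fun n p hn hp hpn =>
    Nat.div_pos (Nat.le_of_dvd hn hpn) hp.pos
  constructor
  · rintro ⟨f, hf⟩ n hn hnr p hp hpn
    rw [hf n hn hnr, hf (n / p) (hdivpos n p hn hp hpn) ((Nat.div_le_self _ _).trans hnr)]
    exact (Int.modEq_iff_dvd.2 (aux_forward f n p hn hp hpn)).symm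
  · intro hb
    suffices H : ∀ m, m ≤ r → ∃ f : Matrix (Fin r) (Fin r) ℤ,
        ∀ n : ℕ, 1 ≤ n → n ≤ m → b n = (f ^ n).trace from H r le_rfl
    intro m
    induction m with
    | zero => exact fun _ => ⟨0, fun n h1 h2 => by omega⟩
    | succ m ih =>
      intro hm
      obtain ⟨f, hf⟩ := ih (by omega)
      have hdvd : ((m + 1 : ℕ) : ℤ) ∣ (f ^ (m + 1)).trace - b (m + 1) := by
        rw [Int.natCast_dvd, Nat.dvd_iff_prime_pow_dvd_dvd]
        intro p k hp hpk
        rw [← Int.natCast_dvd]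
        rcases Nat.eq_zero_or_pos k with rfl | hk
        · simp
        have hpn : p ∣ m + 1 := (dvd_pow_self p (by omega)).trans hpk
        have hle : k ≤ (m + 1).factorization p :=
          (hp.pow_dvd_iff_le_factorization (by omega)).1 hpk
        have h1 := aux_forward f (m + 1) p (by omega) hp hpn
        have h2 := (hb (m + 1) (by omega) hm p hp hpn).dvd
        have hlt : (m + 1) / p < m + 1 := Nat.div_lt_self (by omega) hp.one_lt
        rw [hf ((m + 1) / p) (hdivpos _ p (by omega) hp hpn) (by omega)] at h2
        have h3 := dvd_add h1 h2
        rw [sub_add_sub_cancel] at h3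
        push_cast
        exact (pow_dvd_pow _ hle).trans h3
      obtain ⟨c, hc⟩ := hdvd
      obtain ⟨B, hB⟩ := aux_perturb f m hm c
      obtain ⟨s1, s2⟩ := aux_step f B m c hB
      refine ⟨B, fun n hn hnm => ?_⟩
      rcases Nat.lt_or_ge m n with h | h
      · obtain rfl : n = m + 1 := by omega
        rw [s2]
        push_cast at hc
        linarith
      · rw [s1 n hn h, hf n hn h]
end

section
/- Let R be a commutative ring and M an r × r matrix over R. In the formal power series ring R⟦t⟧, regarding det(1 − t·M) ∈ R[t] as a power series P, one has −t · P′ = P · ∑_{n ≥ 1} Tr(M^n) t^n, where P′ denotes the formal derivative of P. -/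
theorem jacobi_aux {R : Type*} [CommRing R] {r : ℕ}
    (A : Matrix (Fin r) (Fin r) (Polynomial R)) :
    Polynomial.derivative A.det = (A.adjugate * A.map Polynomial.derivative).trace := by
  have h : ∀ i, (A.adjugate * A.map Polynomial.derivative) i i =
      (A.updateCol i (fun k => Polynomial.derivative (A k i))).det := by
    intro i
    rw [← Matrix.cramer_apply, Matrix.cramer_eq_adjugate_mulVec]
    simp [Matrix.mul_apply, Matrix.mulVec, dotProduct]
  simp only [Matrix.trace, Matrix.diag, h]
  simp only [Matrix.det_apply']
  rw [Finset.sum_comm, Polynomial.derivative_sum]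
  refine Finset.sum_congr rfl fun σ _ => ?_
  rw [← Finset.mul_sum, Polynomial.derivative_intCast_mul, Polynomial.derivative_prod_finset]
  congr 1
  refine Finset.sum_congr rfl fun i _ => ?_
  rw [← Finset.prod_erase_mul _ _ (Finset.mem_univ i)]
  congr 1
  · refine Finset.prod_congr rfl fun j hj => ?_
    rw [Matrix.updateCol_ne (Finset.ne_of_mem_erase hj)]
  · simp

open Polynomial PowerSeries in
theorem stmt_16 (R : Type*) [CommRing R] (r : ℕ) (M : Matrix (Fin r) (Fin r) R) :
    -((PowerSeries.X : PowerSeries R) *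
        (↑(Polynomial.derivative ((1 - (Polynomial.X : Polynomial R) • M.map Polynomial.C).det)) :
          PowerSeries R)) =
      (↑((1 - (Polynomial.X : Polynomial R) • M.map Polynomial.C).det) : PowerSeries R) *
        PowerSeries.mk (fun n => if n = 0 then 0 else (M ^ n).trace) := by
  set A : Matrix (Fin r) (Fin r) (Polynomial R) :=
    1 - (Polynomial.X : Polynomial R) • M.map Polynomial.C with hA
  have hA' : A.map Polynomial.derivative = -(M.map Polynomial.C) := by
    ext1 i j
    by_cases hij : i = j <;> simp [hA, Matrix.one_apply, hij]
  let φ : Polynomial R →+* PowerSeries R := Polynomial.coeToPowerSeries.ringHom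
  let B : Matrix (Fin r) (Fin r) (PowerSeries R) := φ.mapMatrix A
  let N : Matrix (Fin r) (Fin r) (PowerSeries R) :=
    (PowerSeries.X : PowerSeries R) • M.map PowerSeries.C
  let S : Matrix (Fin r) (Fin r) (PowerSeries R) :=
    Matrix.of fun i j => PowerSeries.mk fun n => (M ^ n) i j
  let T : Matrix (Fin r) (Fin r) (PowerSeries R) :=
    Matrix.of fun i j => PowerSeries.mk fun n => if n = 0 then 0 else (M ^ n) i j
  have hB : B = 1 - N := by
    ext1 i j
    by_cases hij : i = j <;> simp [B, N, hA, hij, φ] <;> exact mul_comm _ _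
  have hNS : N * S = T := by
    ext i j n
    cases n with
    | zero => simp [N, S, T, Matrix.mul_apply, mul_assoc]
    | succ n =>
      simp [N, S, T, Matrix.mul_apply, mul_assoc, PowerSeries.coeff_succ_X_mul, pow_succ']
  have hST : S - T = 1 := by
    ext i j n
    by_cases hn : n = 0 <;> by_cases hij : i = j <;>
      simp [S, T, hn, hij, Matrix.one_apply, PowerSeries.coeff_one]
  have hBS : B * S = 1 := by rw [hB, sub_mul, one_mul, hNS, hST]
  have hadj : B.adjugate = B.det • S := by
    calc B.adjugate = B.adjugate * (B * S) := by rw [hBS, mul_one]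
      _ = B.det • S := by rw [← mul_assoc, Matrix.adjugate_mul, Matrix.smul_mul, one_mul]
  have hT : T.trace = PowerSeries.mk (fun n => if n = 0 then 0 else (M ^ n).trace) := by
    ext n
    by_cases hn : n = 0 <;> simp [T, Matrix.trace, hn]
  have hdet : φ A.det = B.det := φ.map_det A
  have hder : φ (Polynomial.derivative A.det) =
      -(B.adjugate * M.map PowerSeries.C).trace := by
    rw [jacobi_aux, hA', AddMonoidHom.map_trace φ, mul_neg]
    have : (-(A.adjugate * M.map Polynomial.C)).map φ =
        -(B.adjugate * M.map PowerSeries.C) := by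
      have h1 : φ.mapMatrix (M.map Polynomial.C) = M.map PowerSeries.C := by
        ext1 i j
        simp [φ]
      have h2 := φ.map_adjugate A
      change φ.mapMatrix _ = _
      rw [map_neg, map_mul, h1, h2]
    exact (congrArg Matrix.trace this).trans (Matrix.trace_neg _)
  change -(PowerSeries.X * φ (Polynomial.derivative A.det)) = φ A.det * _
  rw [hder, hdet, ← hT, mul_neg, neg_neg, ← smul_eq_mul, ← Matrix.trace_smul,
    ← Matrix.mul_smul]
  change (B.adjugate * N).trace = _
  rw [hadj, Matrix.smul_mul, Matrix.trace_smul, Matrix.trace_mul_comm, hNS, smul_eq_mul]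
end
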